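/- Let F(z) be a ℂ^{m×m}-valued polynomial and r ∈ ℝ[z₁, …, z_d] a polynomial all of whose irreducible factors are indefinite (each takes both positive and negative values on ℝ^d). If r(z)²·F(z) is an SOS polynomial, then F(z) is an SOS polynomial. -/

import Mathlib

open Matrix MvPolynomial

noncomputable section

/-- Conjugation of the coefficients of a polynomial; `eval z (conjPoly p) = conj (p(z̄))`. -/
def conjPoly {d : ℕ} (p : MvPolynomial (Fin d) ℂ) : MvPolynomial (Fin d) ℂ :=
  MvPolynomial.map (starRingEnd ℂ) p

/-- A real polynomial viewed as a complex one. -/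
def toℂ {d : ℕ} (s : MvPolynomial (Fin d) ℝ) : MvPolynomial (Fin d) ℂ :=
  MvPolynomial.map (algebraMap ℝ ℂ) s

/-- A `ℂ^{m×m}`-valued polynomial is SOS if `F(z) = H(z)H(z̄)*` for some matrix
polynomial `H`. -/
def IsSOSPoly {d m : ℕ} (F : Matrix (Fin m) (Fin m) (MvPolynomial (Fin d) ℂ)) : Prop :=
  ∃ (k : ℕ) (H : Matrix (Fin m) (Fin k) (MvPolynomial (Fin d) ℂ)),
    ∀ i j, F i j = ∑ l, H i l * conjPoly (H j l)

section SignChange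

/-- The substitution `x ↦ x + s • v`, with a new variable `s`, as a ring endomorphism of
`ℝ[x][s]`. -/
def shearHom {σ : Type*} (v : σ → ℝ) :
    Polynomial (MvPolynomial σ ℝ) →+* Polynomial (MvPolynomial σ ℝ) :=
  Polynomial.eval₂RingHom
    (eval₂Hom (Polynomial.C.comp MvPolynomial.C)
      fun i => Polynomial.C (X i) + Polynomial.X * Polynomial.C (MvPolynomial.C (v i)))
    Polynomial.X

theorem shearHom_comp_neg {σ : Type*} (v : σ → ℝ) :
    (shearHom v).comp (shearHom (-v)) = RingHom.id _ := by
  refine Polynomial.ringHom_ext' (MvPolynomial.ringHom_ext (fun a => ?_) fun i => ?_) ?_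
  · simp [shearHom]
  · simp [shearHom]
    ring
  · simp [shearHom]

/-- The shear `x ↦ x + s • v` is an automorphism of `ℝ[x][s]`, with inverse the shear along
`-v`. -/
def shearEquiv {σ : Type*} (v : σ → ℝ) :
    Polynomial (MvPolynomial σ ℝ) ≃+* Polynomial (MvPolynomial σ ℝ) :=
  RingEquiv.ofRingHom (shearHom v) (shearHom (-v)) (shearHom_comp_neg v)
    (by simpa using shearHom_comp_neg (-v))

theorem eval₂_shearEquiv_C {σ : Type*} (v x : σ → ℝ) (s : ℝ) (p : MvPolynomial σ ℝ) :
    (shearEquiv v (Polynomial.C p)).eval₂ (eval x) s = eval (x + s • v) p := by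
  change ((Polynomial.eval₂RingHom (eval x) s).comp ((shearHom v).comp Polynomial.C)) p = _
  congr 1
  refine MvPolynomial.ringHom_ext (fun a => ?_) fun i => ?_ <;> simp [shearHom, mul_comm s]

/-- Over a GCD domain, an irreducible polynomial of positive degree and a polynomial it does not
divide have a nonzero constant in the ideal they generate. -/
theorem exists_ne_zero_C_eq_of_irreducible_of_not_dvd {R : Type*} [CommRing R] [IsDomain R]
    [IsGCDMonoid R] {p q : Polynomial R} (hp : Irreducible p) (hdeg : p.natDegree ≠ 0)
    (hpq : ¬ p ∣ q) : ∃ D : R, D ≠ 0 ∧ ∃ u w, u * p + w * q = Polynomial.C D := by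
  let K := FractionRing R
  have hprim := hp.isPrimitive hdeg
  have hirr : Irreducible (p.map (algebraMap R K)) :=
    hprim.irreducible_iff_irreducible_map_fraction_map.1 hp
  obtain ⟨u, w, huw⟩ := (hirr.isCoprime_or_dvd (q.map (algebraMap R K))).resolve_right
    fun h => hpq (hprim.dvd_of_fraction_map_dvd_fraction_map h)
  obtain ⟨b, hb, hu⟩ := IsLocalization.integerNormalization_spec (nonZeroDivisors R) u
  obtain ⟨c, hc, hw⟩ := IsLocalization.integerNormalization_spec (nonZeroDivisors R) w
  rw [Algebra.smul_def, Polynomial.algebraMap_apply] at hu hw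
  refine ⟨b * c, mul_ne_zero (nonZeroDivisors.ne_zero hb) (nonZeroDivisors.ne_zero hc),
    Polynomial.C c * IsLocalization.integerNormalization (nonZeroDivisors R) u,
    Polynomial.C b * IsLocalization.integerNormalization (nonZeroDivisors R) w, ?_⟩
  apply Polynomial.map_injective (algebraMap R K) (IsFractionRing.injective R K)
  simp only [Polynomial.map_add, Polynomial.map_mul, hu, hw, Polynomial.map_C, map_mul]
  linear_combination Polynomial.C (algebraMap R K b) * Polynomial.C (algebraMap R K c) * huw

theorem MvPolynomial.eq_zero_of_eventually_eval_eq_zero {σ : Type*} [Finite σ]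
    {p : MvPolynomial σ ℝ} {a : σ → ℝ} (h : ∀ᶠ x in nhds a, eval x p = 0) : p = 0 := by
  rw [nhds_pi, Filter.Eventually, Filter.mem_pi'] at h
  obtain ⟨I, s, hs, hsub⟩ := h
  exact MvPolynomial.funext_set s (fun i => infinite_of_mem_nhds _ (hs i)) fun x hx => by
    simpa using hsub fun i _ => hx i trivial

/-- The sign-changing criterion: an irreducible indefinite real polynomial divides every
polynomial that vanishes on its real zero set. -/
theorem dvd_of_indefinite_of_vanishes {σ : Type*} [Finite σ] {t p : MvPolynomial σ ℝ}
    (ht : Irreducible t) {a b : σ → ℝ} (ha : 0 < eval a t) (hb : eval b t < 0)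
    (hp : ∀ x, eval x t = 0 → eval x p = 0) : t ∣ p := by
  by_contra hdvd
  set e := shearEquiv (b - a)
  have hirr : Irreducible (e (Polynomial.C t)) :=
    ((MulEquiv.prime_iff e).2 (Polynomial.prime_C_iff.2 ht.prime)).irreducible
  have hdeg : (e (Polynomial.C t)).natDegree ≠ 0 := by
    intro h
    obtain ⟨c, hc⟩ := Polynomial.natDegree_eq_zero.1 h
    have h0 := eval₂_shearEquiv_C (b - a) a 0 t
    have h1 := eval₂_shearEquiv_C (b - a) a 1 t
    rw [← hc, Polynomial.eval₂_C] at h0 h1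
    simp only [zero_smul, add_zero, one_smul, add_sub_cancel] at h0 h1
    linarith
  have hndvd : ¬ e (Polynomial.C t) ∣ e (Polynomial.C p) := by
    rw [map_dvd_iff]
    exact fun h => hdvd (by simpa using (Polynomial.C_dvd_iff_dvd_coeff _ _).1 h 0)
  obtain ⟨D, hD, u, w, huw⟩ :=
    exists_ne_zero_C_eq_of_irreducible_of_not_dvd hirr hdeg hndvd
  refine hD (MvPolynomial.eq_zero_of_eventually_eval_eq_zero (a := a) ?_)
  have hcont := MvPolynomial.continuous_eval t
  have hpos : ∀ᶠ x in nhds a, 0 < eval x t := hcont.continuousAt.eventually_const_lt ha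
  have hneg : ∀ᶠ x in nhds a, eval (x + (b - a)) t < 0 := by
    have hc : Continuous fun x => eval (x + (b - a)) t := hcont.comp (by fun_prop)
    exact hc.continuousAt.eventually_lt_const (by simpa using hb)
  filter_upwards [hpos, hneg] with x hx0 hx1
  have hline : Continuous fun s : ℝ => eval (x + s • (b - a)) t := hcont.comp (by fun_prop)
  obtain ⟨s, -, hs⟩ := intermediate_value_Icc' zero_le_one hline.continuousOn
    (show (0 : ℝ) ∈ _ by simpa using ⟨hx1.le, hx0.le⟩)
  have key := congrArg (Polynomial.eval₂ (eval x) s) huw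
  rw [Polynomial.eval₂_add, Polynomial.eval₂_mul, Polynomial.eval₂_mul, eval₂_shearEquiv_C,
    eval₂_shearEquiv_C, hp _ hs, Polynomial.eval₂_C] at key
  simpa [hs] using key.symm

end SignChange

section SumOfSquares

variable {d m : ℕ}

theorem conjPoly_toℂ (s : MvPolynomial (Fin d) ℝ) : conjPoly (toℂ s) = toℂ s := by
  rw [conjPoly, toℂ, MvPolynomial.map_map]
  congr 2
  ext x
  simp

theorem eval_ofReal_toℂ (x : Fin d → ℝ) (s : MvPolynomial (Fin d) ℝ) :
    eval (fun i => (x i : ℂ)) (toℂ s) = (eval x s : ℝ) := by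
  rw [toℂ, eval_map]
  exact (MvPolynomial.eval₂_comp_left Complex.ofRealHom (RingHom.id ℝ) x s).symm

theorem eval_ofReal_conjPoly (x : Fin d → ℝ) (p : MvPolynomial (Fin d) ℂ) :
    eval (fun i => (x i : ℂ)) (conjPoly p) =
      starRingEnd ℂ (eval (fun i => (x i : ℂ)) p) := by
  rw [conjPoly, eval_map, eval, coe_eval₂Hom, MvPolynomial.eval₂_comp_left (starRingEnd ℂ)]
  congr 1
  ext i
  simp

theorem exists_eq_toℂ_add_I_mul_toℂ (p : MvPolynomial (Fin d) ℂ) :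
    ∃ A B : MvPolynomial (Fin d) ℝ, p = toℂ A + C Complex.I * toℂ B := by
  induction p using MvPolynomial.induction_on with
  | C z =>
    refine ⟨C z.re, C z.im, ?_⟩
    simp only [toℂ, map_C, ← C_mul, ← C_add]
    congr 1
    simp [mul_comm Complex.I]
  | add p q hp hq =>
    obtain ⟨A, B, rfl⟩ := hp
    obtain ⟨A', B', rfl⟩ := hq
    exact ⟨A + A', B + B', by simp only [toℂ, map_add]; ring⟩
  | mul_X p i hp =>
    obtain ⟨A, B, rfl⟩ := hp
    exact ⟨A * X i, B * X i, by simp only [toℂ, map_mul, map_X]; ring⟩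

/-- The complex version of `dvd_of_indefinite_of_vanishes`. -/
theorem toℂ_dvd_of_indefinite_of_vanishes {t : MvPolynomial (Fin d) ℝ} (ht : Irreducible t)
    {a b : Fin d → ℝ} (ha : 0 < eval a t) (hb : eval b t < 0) {p : MvPolynomial (Fin d) ℂ}
    (hp : ∀ x : Fin d → ℝ, eval x t = 0 → eval (fun i => (x i : ℂ)) p = 0) : toℂ t ∣ p := by
  obtain ⟨A, B, rfl⟩ := exists_eq_toℂ_add_I_mul_toℂ p
  have hAB : ∀ x, eval x t = 0 → eval x A = 0 ∧ eval x B = 0 := fun x hx => by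
    simpa [eval_ofReal_toℂ, Complex.ext_iff] using hp x hx
  have hA : toℂ t ∣ toℂ A :=
    map_dvd (MvPolynomial.map (algebraMap ℝ ℂ))
      (dvd_of_indefinite_of_vanishes ht ha hb fun x hx => (hAB x hx).1)
  have hB : toℂ t ∣ toℂ B :=
    map_dvd (MvPolynomial.map (algebraMap ℝ ℂ))
      (dvd_of_indefinite_of_vanishes ht ha hb fun x hx => (hAB x hx).2)
  exact dvd_add hA (hB.mul_left _)

theorem toℂ_ne_zero {t : MvPolynomial (Fin d) ℝ} (ht : t ≠ 0) : toℂ t ≠ 0 :=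
  (map_ne_zero_iff _ (map_injective _ (algebraMap ℝ ℂ).injective)).2 ht

theorem isSOSPoly_of_dvd {F : Matrix (Fin m) (Fin m) (MvPolynomial (Fin d) ℂ)}
    {t : MvPolynomial (Fin d) ℝ} (ht : t ≠ 0) {k : ℕ}
    {H : Matrix (Fin m) (Fin k) (MvPolynomial (Fin d) ℂ)}
    (hH : ∀ i j, toℂ t ^ 2 * F i j = ∑ l, H i l * conjPoly (H j l))
    (hdvd : ∀ i l, toℂ t ∣ H i l) : IsSOSPoly F := by
  choose G hG using hdvd
  refine ⟨k, Matrix.of G, fun i j => mul_left_cancel₀ (pow_ne_zero 2 (toℂ_ne_zero ht)) ?_⟩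
  rw [hH, Finset.mul_sum]
  refine Finset.sum_congr rfl fun l _ => ?_
  have hconj : conjPoly (H j l) = toℂ t * conjPoly (G j l) := by
    rw [hG, conjPoly, map_mul, ← conjPoly, conjPoly_toℂ, conjPoly]
  rw [hconj, hG, Matrix.of_apply, Matrix.of_apply]
  ring

theorem isSOSPoly_of_irreducible_sq_mul {F : Matrix (Fin m) (Fin m) (MvPolynomial (Fin d) ℂ)}
    {t : MvPolynomial (Fin d) ℝ} (ht : Irreducible t) {a b : Fin d → ℝ} (ha : 0 < eval a t)
    (hb : eval b t < 0) (hSOS : IsSOSPoly (Matrix.of fun i j => toℂ t ^ 2 * F i j)) :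
    IsSOSPoly F := by
  obtain ⟨k, H, hH⟩ := hSOS
  refine isSOSPoly_of_dvd ht.ne_zero hH fun i l =>
    toℂ_dvd_of_indefinite_of_vanishes ht ha hb fun x hx => ?_
  have h := congrArg (eval fun i => (x i : ℂ)) (hH i i)
  simp only [Matrix.of_apply, map_mul, map_pow, map_sum, eval_ofReal_toℂ, hx,
    eval_ofReal_conjPoly, Complex.mul_conj, ← Complex.ofReal_sum] at h
  have hsum : ∑ l, Complex.normSq (eval (fun i => (x i : ℂ)) (H i l)) = 0 := by
    simpa using congrArg Complex.re h.symm
  rw [Finset.sum_eq_zero_iff_of_nonneg fun _ _ => Complex.normSq_nonneg _] at hsum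
  exact Complex.normSq_eq_zero.1 (hsum l (Finset.mem_univ l))

end SumOfSquares

/-- if all irreducible factors of the (nonzero) real polynomial `r` are
indefinite and `r²F` is an SOS polynomial, then `F` itself is SOS. -/
theorem sos_cancel_indefinite_denominator (d m : ℕ)
    (F : Matrix (Fin m) (Fin m) (MvPolynomial (Fin d) ℂ))
    (r : MvPolynomial (Fin d) ℝ) (hr : r ≠ 0)
    (hfac : ∀ t : MvPolynomial (Fin d) ℝ, Irreducible t → t ∣ r →
      (∃ a : Fin d → ℝ, 0 < eval a t) ∧ (∃ b : Fin d → ℝ, eval b t < 0))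
    (hSOS : IsSOSPoly (Matrix.of fun i j => (toℂ r) ^ 2 * F i j)) :
    IsSOSPoly F := by
  induction r using WfDvdMonoid.induction_on_irreducible generalizing F with
  | zero => exact absurd rfl hr
  | unit u hu =>
    obtain ⟨k, H, hH⟩ := hSOS
    exact isSOSPoly_of_dvd hr hH fun i l =>
      (hu.map (MvPolynomial.map (algebraMap ℝ ℂ))).dvd
  | mul r t hr0 ht ih =>
    obtain ⟨⟨a, ha⟩, b, hb⟩ := hfac t ht (dvd_mul_right t r)
    refine ih F hr0 (fun s hs hdvd => hfac s hs (hdvd.mul_left t))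
      (isSOSPoly_of_irreducible_sq_mul ht ha hb ?_)
    simpa only [toℂ, map_mul, mul_pow, mul_assoc, Matrix.of_apply] using hSOS
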